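/- (Singular series lower bound) There exists an absolute constant c > 0 such that for every real Q ≥ 2 and every even Gaussian integer x: Σ_q |μ(q)| τ_q(x) / φ(q)² ≥ c, where the sum runs over one representative q of each associate class of Q-smooth Gaussian integers (including the units), and the sum is real-valued. -/

import Mathlib

open Complex GaussianInt MeasureTheory
open scoped Real ENNReal

noncomputable section
attribute [local instance] Classical.propDecidable

/-- The real inner product on `ℂ ≅ ℝ²`: `⟨z, w⟩ = Re z · Re w + Im z · Im w`. -/
def cip (z w : ℂ) : ℝ := z.re * w.re + z.im * w.im

/-- `e(t) = exp(2πit)`. -/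
def e2 (t : ℝ) : ℂ := Complex.exp (2 * Real.pi * Complex.I * t)

/-- The fundamental box `B_q` of residues modulo `q`:
`B_q = {r : 0 ≤ ⟨r,q⟩ < N(q), 0 ≤ ⟨r,iq⟩ < N(q)}`. -/
def Bq (q : GaussianInt) : Set GaussianInt :=
  {r | 0 ≤ cip (toComplex r) (toComplex q) ∧
       cip (toComplex r) (toComplex q) < Complex.normSq (toComplex q) ∧
       0 ≤ cip (toComplex r) (Complex.I * toComplex q) ∧
       cip (toComplex r) (Complex.I * toComplex q) < Complex.normSq (toComplex q)}

/-- `𝔸_q`, the reduced residues in `B_q` (gcd with `q` a unit). -/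
def Aq (q : GaussianInt) : Set GaussianInt :=
  {r | r ∈ Bq q ∧ IsUnit (EuclideanDomain.gcd r q)}

/-- The Euler totient on `ℤ[i]`: `φ(q) = |𝔸_q|`. -/
def gphi (q : GaussianInt) : ℕ := Nat.card (Aq q)

/-- The Gaussian Ramanujan sum `τ_q(x) = Σ_{n ∈ 𝔸_q} e(⟨x, n/q⟩)`. -/
def gtau (q x : GaussianInt) : ℂ :=
  ∑' n : Aq q, e2 (cip (toComplex x) (toComplex (n : GaussianInt) / toComplex q))

/-- The Möbius function on `ℤ[i]`: `(-1)^k` on squarefree numbers with `k`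
pairwise non-associate prime factors (so `1` on units), and `0` otherwise. -/
def gmu (n : GaussianInt) : ℤ :=
  if n ≠ 0 ∧ Squarefree n then (-1) ^ (UniqueFactorizationMonoid.factors n).card else 0

/-- The von Mangoldt function on `ℤ[i]`: `Λ(n) = log N(ρ)` if `n` is a unit times
`ρ^k` for a Gaussian prime `ρ` and `k ≥ 1`, and `0` otherwise. -/
def gvm (n : GaussianInt) : ℝ :=
  if h : ∃ ρ : GaussianInt, Irreducible ρ ∧
      ∃ k : ℕ, 1 ≤ k ∧ ∃ u : GaussianInt, IsUnit u ∧ n = u * ρ ^ k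
  then Real.log (Complex.normSq (toComplex h.choose)) else 0

/-- `ω ⊆ 𝕋 = ℝ/2πℤ` is an interval (arc) of length `l`. -/
def IsArc (ω : Set Real.Angle) (l : ℝ) : Prop :=
  ∃ a : ℝ, ω = (fun θ : ℝ => (θ : Real.Angle)) '' Set.Ico a (a + l)

/-- `arg z ∈ ω`, as a condition in `𝕋`. -/
def argIn (z : ℂ) (ω : Set Real.Angle) : Prop := (↑(Complex.arg z) : Real.Angle) ∈ ω

/-- The normalized sector average kernel `M_N^ω`. -/
def Msec (ω : Set Real.Angle) (l : ℝ) (N : ℕ) (n : GaussianInt) : ℝ :=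
  if Zsqrtd.norm n < (N : ℤ) ∧ argIn (toComplex n) ω then 2 * Real.pi / (l * N) else 0

/-- The weighted sector average kernel `A_N^ω` (with von Mangoldt weights). -/
def Asec (ω : Set Real.Angle) (l : ℝ) (N : ℕ) (n : GaussianInt) : ℂ :=
  if Zsqrtd.norm n < (N : ℤ) ∧ argIn (toComplex n) ω then
    ((2 * Real.pi / (l * N) : ℝ) : ℂ) * (gvm n : ℂ) else 0

/-- The canonical representative of a nonzero associate class in `ℤ[i]`. -/
def IsCanon (z : GaussianInt) : Prop := 0 < z.re ∧ 0 ≤ z.im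

/-- `Φ(a, q) = τ_q(a)/φ(q)`. -/
def Phi (a q : GaussianInt) : ℂ := gtau q a / (gphi q : ℂ)

/-- `Â_N^ω(α)`: the Fourier transform of the weighted sector average. -/
def Ahat (ω : Set Real.Angle) (l : ℝ) (N : ℕ) (α : ℂ) : ℂ :=
  ((2 * Real.pi / (l * N) : ℝ) : ℂ) *
    ∑' n : {m : GaussianInt // Zsqrtd.norm m < (N : ℤ) ∧ argIn (toComplex m) ω},
      (gvm (n : GaussianInt) : ℂ) * e2 (cip (toComplex (n : GaussianInt)) α)

/-- `M̂_N^ω(β)`: the Fourier transform of the sector average. -/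
def Mhat (ω : Set Real.Angle) (l : ℝ) (N : ℕ) (β : ℂ) : ℂ :=
  ((2 * Real.pi / (l * N) : ℝ) : ℂ) *
    ∑' n : {m : GaussianInt // Zsqrtd.norm m < (N : ℤ) ∧ argIn (toComplex m) ω},
      e2 (cip (toComplex (n : GaussianInt)) β)

/-- The tensor Fejér-type bump `η(ξ₁+iξ₂) = (1-|ξ₁|)₊ (1-|ξ₂|)₊`. -/
def eta (ξ : ℂ) : ℝ := max 0 (1 - |ξ.re|) * max 0 (1 - |ξ.im|)

/-- `Δ_s(ξ) = η(16^s ξ)`. -/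
def Delta (s : ℕ) (ξ : ℂ) : ℝ := eta ((16 : ℂ) ^ s * ξ)

/-- `Δ̌_{q₀}(n) = ∫_{[-1/2,1/2)²} Δ_{q₀}(ξ) e(⟨n, ξ⟩) dξ`. -/
def DeltaCheck (q₀ : ℕ) (n : GaussianInt) : ℂ :=
  ∫ p in (Set.Ico (-(1:ℝ)/2) (1/2)) ×ˢ (Set.Ico (-(1:ℝ)/2) (1/2)),
    ((Delta q₀ ((p.1 : ℂ) + (p.2 : ℂ) * Complex.I) : ℝ) : ℂ) *
      e2 (cip (toComplex n) ((p.1 : ℂ) + (p.2 : ℂ) * Complex.I))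

/-- The Low part `Lo_{Q,N}^ω` with `Q = 2^{q₀}`. -/
def Lo (ω : Set Real.Angle) (l : ℝ) (N : ℕ) (q₀ : ℕ) (x : GaussianInt) : ℂ :=
  (∑' y : GaussianInt, ((Msec ω l N y : ℝ) : ℂ) * DeltaCheck q₀ (x - y)) *
    ∑' q : {q : GaussianInt // IsCanon q ∧ (Zsqrtd.norm q : ℝ) < 2 ^ q₀},
      ∑' a : Aq (q : GaussianInt),
        Phi (a : GaussianInt) (star (q : GaussianInt)) *
          e2 (cip (toComplex x) (toComplex (a : GaussianInt) / toComplex (q : GaussianInt)))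

/-- Distance from `β ∈ ℂ` to the nearest Gaussian integer. -/
def distZi (β : ℂ) : ℝ := Metric.infDist β (Set.range fun n : GaussianInt => toComplex n)

/-- `q` is `Q`-smooth: squarefree with all prime factors of norm at most `Q`. -/
def QSmooth (Q : ℝ) (q : GaussianInt) : Prop :=
  Squarefree q ∧ ∀ ρ : GaussianInt, Irreducible ρ → ρ ∣ q → (Zsqrtd.norm ρ : ℝ) ≤ Q


lemma e2_add (s t : ℝ) : e2 (s + t) = e2 s * e2 t := by
  simp only [e2, ← Complex.exp_add]
  push_cast
  ring_nf

lemma e2_eq_one_iff (t : ℝ) : e2 t = 1 ↔ ∃ k : ℤ, t = k := by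
  rw [e2, Complex.exp_eq_one_iff]
  refine exists_congr fun k => ?_
  rw [mul_comm, mul_left_inj' Complex.two_pi_I_ne_zero]
  exact_mod_cast Iff.rfl

lemma e2_zero : e2 0 = 1 := (e2_eq_one_iff 0).2 ⟨0, by simp⟩

lemma cip_add_right (z w v : ℂ) : cip z (w + v) = cip z w + cip z v := by
  simp only [cip, Complex.add_re, Complex.add_im]
  ring

lemma cip_toComplex (x y : GaussianInt) :
    cip (toComplex x) (toComplex y) = ((x.re * y.re + x.im * y.im : ℤ) : ℝ) := by
  simp [cip, ← GaussianInt.intCast_re, ← GaussianInt.intCast_im]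

lemma e2_cip_toComplex (x y : GaussianInt) : e2 (cip (toComplex x) (toComplex y)) = 1 :=
  (e2_eq_one_iff _).2 ⟨_, cip_toComplex x y⟩

lemma gaussian_norm_eq (z : GaussianInt) : z.norm = z.re ^ 2 + z.im ^ 2 := by
  rw [Zsqrtd.norm_def]
  ring

/-- The additive character `n ↦ e(⟨x, n/q⟩)` of `ℤ[i]`. -/
def gaussChar (q x n : GaussianInt) : ℂ := e2 (cip (toComplex x) (toComplex n / toComplex q))

lemma gaussChar_add (q x n m : GaussianInt) :
    gaussChar q x (n + m) = gaussChar q x n * gaussChar q x m := by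
  rw [gaussChar, toComplex_add, add_div, cip_add_right, e2_add, gaussChar, gaussChar]

lemma gaussChar_mul_left {q : GaussianInt} (hq : q ≠ 0) (x m : GaussianInt) :
    gaussChar q x (q * m) = 1 := by
  have h : toComplex q ≠ 0 := by rwa [Ne, toComplex_eq_zero]
  rw [gaussChar, toComplex_mul, mul_div_cancel_left₀ _ h, e2_cip_toComplex]

lemma gaussChar_zero_right (q x : GaussianInt) : gaussChar q x 0 = 1 := by
  simp [gaussChar, cip, e2_zero]

lemma gaussChar_eq_of_dvd_sub {q : GaussianInt} (hq : q ≠ 0) (x : GaussianInt)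
    {n m : GaussianInt} (h : q ∣ n - m) : gaussChar q x n = gaussChar q x m := by
  obtain ⟨k, hk⟩ := h
  rw [show n = m + q * k by rw [← hk]; ring, gaussChar_add, gaussChar_mul_left hq, mul_one]

lemma gaussChar_mul_add_mul {q₁ q₂ : GaussianInt} (h₁ : q₁ ≠ 0) (h₂ : q₂ ≠ 0)
    (x a b : GaussianInt) :
    gaussChar (q₁ * q₂) x (a * q₂ + b * q₁) = gaussChar q₁ x a * gaussChar q₂ x b := by
  have h₁' : toComplex q₁ ≠ 0 := by rwa [Ne, toComplex_eq_zero]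
  have h₂' : toComplex q₂ ≠ 0 := by rwa [Ne, toComplex_eq_zero]
  rw [gaussChar_add]
  congr 1 <;> simp only [gaussChar, toComplex_mul] <;> congr 2 <;> field_simp

lemma gaussChar_eq_one_of_dvd {q x : GaussianInt} (hq : q ≠ 0) (h : q ∣ star x)
    (n : GaussianInt) : gaussChar q x n = 1 := by
  obtain ⟨k, hk⟩ := h
  have hx : x = star q * star k := by rw [← star_star x, hk, star_mul, mul_comm]
  have h' : toComplex q ≠ 0 := by rwa [Ne, toComplex_eq_zero]
  have : cip (toComplex x) (toComplex n / toComplex q) = cip (toComplex (star k)) (toComplex n) := by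
    have key : ∀ z w : ℂ, cip z w = (star z * w).re := fun z w => by simp [cip]
    rw [key, key, hx, toComplex_mul, toComplex_star]
    congr 1
    simp only [star_mul', RCLike.star_def, Complex.conj_conj]
    field_simp
  rw [gaussChar, this, e2_cip_toComplex]

lemma dvd_of_gaussChar_eq_one {q x : GaussianInt} (hq : q ≠ 0)
    (h : ∀ n, gaussChar q x n = 1) : q ∣ star x := by
  have h' : toComplex q ≠ 0 := by rwa [Ne, toComplex_eq_zero]
  have key : ∀ z w : ℂ, cip z w = (star z * w).re := fun z w => by simp [cip]
  obtain ⟨k, hk⟩ := (e2_eq_one_iff _).1 (h 1)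
  obtain ⟨l, hl⟩ := (e2_eq_one_iff _).1 (h ⟨0, 1⟩)
  refine ⟨⟨k, -l⟩, ?_⟩
  rw [← toComplex_inj, toComplex_mul, toComplex_star, mul_comm, ← div_eq_iff h']
  rw [key] at hk hl
  apply Complex.ext
  · rw [re_toComplex, ← hk, toComplex_one, mul_one_div]
    rfl
  · rw [im_toComplex, Int.cast_neg, ← hl, toComplex_def', ← mul_div_assoc, mul_div_right_comm]
    simp

lemma mem_Bq_iff (q r : GaussianInt) :
    r ∈ Bq q ↔ 0 ≤ (r * star q).re ∧ (r * star q).re < q.norm ∧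
      0 ≤ (r * star q).im ∧ (r * star q).im < q.norm := by
  have h₁ : cip (toComplex r) (toComplex q) = ((r * star q).re : ℝ) := by
    rw [cip_toComplex]
    simp
  have h₂ : cip (toComplex r) (Complex.I * toComplex q) = ((r * star q).im : ℝ) := by
    simp [cip, ← GaussianInt.intCast_re, ← GaussianInt.intCast_im]
  simp only [Bq, Set.mem_ofPred_eq, h₁, h₂, ← intCast_real_norm]
  norm_cast

lemma mul_star_self_eq_norm (q : GaussianInt) : q * star q = (q.norm : GaussianInt) := by
  rw [Zsqrtd.norm_eq_mul_conj]

lemma Bq_finite (q : GaussianInt) : (Bq q).Finite := by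
  rcases eq_or_ne q 0 with rfl | hq
  · convert Set.finite_empty
    ext r
    simp [mem_Bq_iff]
  · have hinj : Set.InjOn (fun r : GaussianInt => ((r * star q).re, (r * star q).im)) (Bq q) := by
      intro r _ s _ h
      have h' : r * star q = s * star q := Zsqrtd.ext (congrArg Prod.fst h) (congrArg Prod.snd h)
      exact mul_right_cancel₀ (star_ne_zero.2 hq) h'
    refine Set.Finite.of_finite_image (Set.Finite.subset
      ((Set.finite_Icc 0 q.norm).prod (Set.finite_Icc 0 q.norm)) ?_) hinj
    rintro _ ⟨r, hr, rfl⟩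
    obtain ⟨h1, h2, h3, h4⟩ := (mem_Bq_iff q r).1 hr
    exact ⟨⟨h1, h2.le⟩, ⟨h3, h4.le⟩⟩

lemma eq_of_mem_Bq {q r s : GaussianInt} (hr : r ∈ Bq q) (hs : s ∈ Bq q) (h : q ∣ r - s) :
    r = s := by
  obtain ⟨k, hk⟩ := h
  obtain ⟨h1, h2, h3, h4⟩ := (mem_Bq_iff q r).1 hr
  obtain ⟨h5, h6, h7, h8⟩ := (mem_Bq_iff q s).1 hs
  have e : r * star q - s * star q = (q.norm : GaussianInt) * k := by
    rw [← mul_star_self_eq_norm, ← sub_mul, hk]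
    ring
  have er := congrArg Zsqrtd.re e
  have ei := congrArg Zsqrtd.im e
  rw [Zsqrtd.re_sub, Zsqrtd.re_smul] at er
  rw [Zsqrtd.im_sub, Zsqrtd.im_smul] at ei
  have hk0 : k = 0 := by
    apply Zsqrtd.ext
    · change k.re = 0
      by_contra hne
      rcases lt_or_gt_of_ne hne with h | h <;> nlinarith
    · change k.im = 0
      by_contra hne
      rcases lt_or_gt_of_ne hne with h | h <;> nlinarith
  rw [hk0, mul_zero, sub_eq_zero] at hk
  exact hk

lemma exists_mem_Bq {q : GaussianInt} (hq : q ≠ 0) (n : GaussianInt) :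
    ∃ r ∈ Bq q, q ∣ n - r := by
  have hN : 0 < q.norm := GaussianInt.norm_pos.2 hq
  set k : GaussianInt := ⟨(n * star q).re / q.norm, (n * star q).im / q.norm⟩ with hk
  refine ⟨n - q * k, ?_, ⟨k, by ring⟩⟩
  have e : (n - q * k) * star q = n * star q - (q.norm : GaussianInt) * k := by
    rw [← mul_star_self_eq_norm]
    ring
  rw [mem_Bq_iff, e, Zsqrtd.re_sub, Zsqrtd.re_smul, Zsqrtd.im_sub, Zsqrtd.im_smul]
  have a1 := Int.emod_add_mul_ediv (n * star q).re q.norm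
  have a2 := Int.emod_nonneg (n * star q).re hN.ne'
  have a3 := Int.emod_lt_of_pos (n * star q).re hN
  have b1 := Int.emod_add_mul_ediv (n * star q).im q.norm
  have b2 := Int.emod_nonneg (n * star q).im hN.ne'
  have b3 := Int.emod_lt_of_pos (n * star q).im hN
  refine ⟨?_, ?_, ?_, ?_⟩ <;> simp only [hk] <;> linarith

lemma mem_Aq_iff (q r : GaussianInt) : r ∈ Aq q ↔ r ∈ Bq q ∧ IsCoprime r q := by
  rw [Aq, Set.mem_ofPred_eq, EuclideanDomain.gcd_isUnit_iff]

lemma Aq_finite (q : GaussianInt) : (Aq q).Finite :=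
  (Bq_finite q).subset fun _ h => h.1

lemma gtau_eq_sum (q x : GaussianInt) :
    gtau q x = ∑ n ∈ (Aq_finite q).toFinset, gaussChar q x n := by
  rw [← Finset.tsum_subtype', gtau, Set.Finite.coe_toFinset]
  rfl

lemma gtau_zero_right (q : GaussianInt) : gtau q 0 = gphi q := by
  have h : ∀ n, gaussChar q 0 n = 1 := fun n => by simp [gaussChar, cip, e2_zero]
  rw [gtau_eq_sum, gphi, Nat.card_eq_card_finite_toFinset (Aq_finite q)]
  simp [h]

lemma isCoprime_of_dvd_sub {q n r : GaussianInt} (h : q ∣ n - r) (hn : IsCoprime n q) :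
    IsCoprime r q := by
  obtain ⟨k, hk⟩ := h
  rw [show n = r + q * k by rw [← hk]; ring] at hn
  exact IsCoprime.add_mul_left_left_iff.1 hn

theorem gtau_mul {q₁ q₂ : GaussianInt} (h₁ : q₁ ≠ 0) (h₂ : q₂ ≠ 0) (h : IsCoprime q₁ q₂)
    (x : GaussianInt) : gtau (q₁ * q₂) x = gtau q₁ x * gtau q₂ x := by
  have hq : q₁ * q₂ ≠ 0 := mul_ne_zero h₁ h₂
  choose red hmem hdvd using exists_mem_Bq hq
  rw [gtau_eq_sum, gtau_eq_sum, gtau_eq_sum, Finset.sum_mul_sum, ← Finset.sum_product']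
  symm
  refine Finset.sum_bij (fun p _ => red (p.1 * q₂ + p.2 * q₁)) ?_ ?_ ?_ ?_
  · rintro ⟨a, b⟩ hab
    simp only [Finset.mem_product, Set.Finite.mem_toFinset, mem_Aq_iff] at hab ⊢
    obtain ⟨⟨_, ha⟩, _, hb⟩ := hab
    refine ⟨hmem _, isCoprime_of_dvd_sub (hdvd _) (IsCoprime.mul_right ?_ ?_)⟩
    · rw [IsCoprime.add_mul_right_left_iff]
      exact ha.mul_left h.symm
    · rw [add_comm, IsCoprime.add_mul_right_left_iff]
      exact hb.mul_left h
  · rintro ⟨a, b⟩ hab ⟨a', b'⟩ hab' e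
    simp only [Finset.mem_product, Set.Finite.mem_toFinset, mem_Aq_iff] at hab hab'
    have hd : q₁ * q₂ ∣ (a * q₂ + b * q₁) - (a' * q₂ + b' * q₁) := by
      have := dvd_sub (hdvd (a * q₂ + b * q₁)) (hdvd (a' * q₂ + b' * q₁))
      simp only at e
      rw [e] at this
      simpa using this
    have d₁ : q₁ ∣ a - a' := by
      refine h.dvd_of_dvd_mul_right ?_
      have := dvd_sub ((dvd_mul_right q₁ q₂).trans hd) (dvd_mul_left q₁ (b - b'))
      convert this using 1
      ring
    have d₂ : q₂ ∣ b - b' := by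
      refine h.symm.dvd_of_dvd_mul_right ?_
      have := dvd_sub ((dvd_mul_left q₂ q₁).trans hd) (dvd_mul_left q₂ (a - a'))
      convert this using 1
      ring
    exact Prod.ext (eq_of_mem_Bq hab.1.1 hab'.1.1 d₁) (eq_of_mem_Bq hab.2.1 hab'.2.1 d₂)
  · intro n hn
    simp only [Set.Finite.mem_toFinset, mem_Aq_iff] at hn
    obtain ⟨u, v, huv⟩ := id h
    obtain ⟨a, ha, da⟩ := exists_mem_Bq h₁ (n * v)
    obtain ⟨b, hb, db⟩ := exists_mem_Bq h₂ (n * u)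
    have hvc : IsCoprime v q₁ := ⟨q₂, u, by rw [← huv]; ring⟩
    have huc : IsCoprime u q₂ := ⟨q₁, v, by rw [← huv]; ring⟩
    obtain ⟨hn₁, hn₂⟩ := IsCoprime.mul_right_iff.1 hn.2
    refine ⟨(a, b), ?_, ?_⟩
    · simp only [Finset.mem_product, Set.Finite.mem_toFinset, mem_Aq_iff]
      exact ⟨⟨ha, isCoprime_of_dvd_sub da (hn₁.mul_left hvc)⟩,
        hb, isCoprime_of_dvd_sub db (hn₂.mul_left huc)⟩
    · refine eq_of_mem_Bq (hmem _) hn.1 ?_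
      obtain ⟨k, hk⟩ := da
      obtain ⟨l, hl⟩ := db
      obtain ⟨m, hm⟩ := hdvd (a * q₂ + b * q₁)
      refine ⟨- m - k - l, ?_⟩
      linear_combination -hm - q₂ * hk - q₁ * hl + n * huv
  · rintro ⟨a, b⟩ _
    rw [← gaussChar_mul_add_mul h₁ h₂]
    exact gaussChar_eq_of_dvd_sub hq x (hdvd _)

lemma gphi_mul {q₁ q₂ : GaussianInt} (h₁ : q₁ ≠ 0) (h₂ : q₂ ≠ 0) (h : IsCoprime q₁ q₂) :
    (gphi (q₁ * q₂) : ℂ) = gphi q₁ * gphi q₂ := by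
  simp only [← gtau_zero_right, gtau_mul h₁ h₂ h]

lemma gtau_of_isUnit {u : GaussianInt} (hu : IsUnit u) (x : GaussianInt) : gtau u x = 1 := by
  have hA : (Aq_finite u).toFinset = {0} := by
    have h0 : (0 : GaussianInt) ∈ Bq u := by
      rw [mem_Bq_iff]
      simp [GaussianInt.norm_pos.2 hu.ne_zero]
    ext r
    rw [Set.Finite.mem_toFinset, mem_Aq_iff, Finset.mem_singleton]
    refine ⟨fun h => eq_of_mem_Bq h.1 h0 hu.dvd, ?_⟩
    rintro rfl
    exact ⟨h0, isCoprime_zero_left.2 hu⟩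
  rw [gtau_eq_sum, hA, Finset.sum_singleton, gaussChar_zero_right]

lemma gphi_of_isUnit {u : GaussianInt} (hu : IsUnit u) : (gphi u : ℂ) = 1 := by
  rw [← gtau_zero_right, gtau_of_isUnit hu]

lemma sum_Bq_gaussChar_eq_zero {q x : GaussianInt} (hq : q ≠ 0) (h : ¬ q ∣ star x) :
    ∑ n ∈ (Bq_finite q).toFinset, gaussChar q x n = 0 := by
  obtain ⟨m, hm⟩ : ∃ m, gaussChar q x m ≠ 1 := by
    by_contra! hall
    exact h (dvd_of_gaussChar_eq_one hq hall)
  choose red hmem hdvd using exists_mem_Bq hq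
  have key : ∑ n ∈ (Bq_finite q).toFinset, gaussChar q x n * gaussChar q x m =
      ∑ n ∈ (Bq_finite q).toFinset, gaussChar q x n := by
    refine Finset.sum_bij' (fun n _ => red (n + m)) (fun n _ => red (n - m)) ?_ ?_ ?_ ?_ ?_
    · intro n _
      exact (Set.Finite.mem_toFinset _).2 (hmem _)
    · intro n _
      exact (Set.Finite.mem_toFinset _).2 (hmem _)
    · intro n hn
      refine eq_of_mem_Bq (hmem _) ((Set.Finite.mem_toFinset _).1 hn) ?_
      have := dvd_add (hdvd (red (n + m) - m)) (hdvd (n + m))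
      rw [← dvd_neg]
      convert this using 1
      ring
    · intro n hn
      refine eq_of_mem_Bq (hmem _) ((Set.Finite.mem_toFinset _).1 hn) ?_
      have := dvd_add (hdvd (red (n - m) + m)) (hdvd (n - m))
      rw [← dvd_neg]
      convert this using 1
      ring
    · intro n _
      rw [← gaussChar_add]
      exact gaussChar_eq_of_dvd_sub hq x (hdvd _)
  rw [← Finset.sum_mul] at key
  by_contra hne
  exact hm ((mul_eq_left₀ hne).1 key)

lemma Aq_toFinset_of_irreducible {p : GaussianInt} (hp : Irreducible p) :
    (Aq_finite p).toFinset = (Bq_finite p).toFinset.erase 0 := by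
  have h0 : (0 : GaussianInt) ∈ Bq p := by
    rw [mem_Bq_iff]
    simp [GaussianInt.norm_pos.2 hp.ne_zero]
  ext r
  rw [Finset.mem_erase, Set.Finite.mem_toFinset, Set.Finite.mem_toFinset, mem_Aq_iff,
    isCoprime_comm, hp.coprime_iff_not_dvd, and_comm]
  refine and_congr_left fun hr => not_congr ⟨fun h => ?_, ?_⟩
  · exact eq_of_mem_Bq hr h0 (by rwa [sub_zero])
  · rintro rfl
    exact dvd_zero p

lemma gtau_of_dvd {q x : GaussianInt} (hq : q ≠ 0) (h : q ∣ star x) : gtau q x = gphi q := by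
  rw [← gtau_zero_right, gtau_eq_sum, gtau_eq_sum]
  refine Finset.sum_congr rfl fun n _ => ?_
  rw [gaussChar_eq_one_of_dvd hq h, gaussChar_eq_one_of_dvd hq (by simp)]

lemma gtau_irreducible_of_not_dvd {p x : GaussianInt} (hp : Irreducible p) (h : ¬ p ∣ star x) :
    gtau p x = -1 := by
  have h0 : (0 : GaussianInt) ∈ (Bq_finite p).toFinset := by
    rw [Set.Finite.mem_toFinset, mem_Bq_iff]
    simp [GaussianInt.norm_pos.2 hp.ne_zero]
  have := Finset.sum_erase_add _ (gaussChar p x) h0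
  rw [sum_Bq_gaussChar_eq_zero hp.ne_zero h, gaussChar_zero_right] at this
  rw [gtau_eq_sum, Aq_toFinset_of_irreducible hp]
  exact eq_neg_of_add_eq_zero_left this

lemma gphi_add_one_of_irreducible {p : GaussianInt} (hp : Irreducible p) :
    gphi p + 1 = (Bq_finite p).toFinset.card := by
  have h0 : (0 : GaussianInt) ∈ (Bq_finite p).toFinset := by
    rw [Set.Finite.mem_toFinset, mem_Bq_iff]
    simp [GaussianInt.norm_pos.2 hp.ne_zero]
  rw [gphi, Nat.card_eq_card_finite_toFinset (Aq_finite p), Aq_toFinset_of_irreducible hp,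
    Finset.card_erase_add_one h0]

lemma norm_le_of_dvd {q n : GaussianInt} (hn : n ≠ 0) (h : q ∣ n) : q.norm ≤ n.norm := by
  obtain ⟨k, rfl⟩ := h
  rw [Zsqrtd.norm_mul]
  have h1 := GaussianInt.norm_pos.2 (left_ne_zero_of_mul hn)
  have h2 := GaussianInt.norm_pos.2 (right_ne_zero_of_mul hn)
  nlinarith

/-- A square of lattice points whose diagonal is shorter than `q` embeds in the residues. -/
lemma sq_le_card_Bq {q : GaussianInt} (hq : q ≠ 0) {K : ℕ} (hK : 2 * (K : ℤ) ^ 2 < q.norm) :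
    (K + 1) ^ 2 ≤ (Bq_finite q).toFinset.card := by
  choose red hmem hdvd using exists_mem_Bq hq
  have hcard : (Finset.range (K + 1) ×ˢ Finset.range (K + 1)).card = (K + 1) ^ 2 := by
    rw [Finset.card_product, Finset.card_range, sq]
  rw [← hcard]
  refine Finset.card_le_card_of_injOn (fun c => red ⟨(c.1 : ℤ), (c.2 : ℤ)⟩) ?_ ?_
  · intro c _
    simpa using hmem _
  · rintro ⟨a, b⟩ hab ⟨c, d⟩ hcd e
    simp only [Finset.coe_product, Finset.coe_range, Set.mem_prod, Set.mem_Iio] at hab hcd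
    simp only at e
    have hd : q ∣ (⟨(a : ℤ), (b : ℤ)⟩ : GaussianInt) - ⟨(c : ℤ), (d : ℤ)⟩ := by
      have := dvd_sub (hdvd ⟨(a : ℤ), (b : ℤ)⟩) (hdvd ⟨(c : ℤ), (d : ℤ)⟩)
      rw [e] at this
      simpa using this
    by_contra hne
    have hne' : (⟨(a : ℤ), (b : ℤ)⟩ : GaussianInt) - ⟨(c : ℤ), (d : ℤ)⟩ ≠ 0 := by
      rw [sub_ne_zero]
      intro h
      have hr := congrArg Zsqrtd.re h
      have hi := congrArg Zsqrtd.im h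
      simp only [Nat.cast_inj] at hr hi
      exact hne (by rw [hr, hi])
    have hle := norm_le_of_dvd hne' hd
    rw [gaussian_norm_eq (_ - _)] at hle
    simp only [Zsqrtd.re_sub, Zsqrtd.im_sub] at hle
    have h1 : ((a : ℤ) - c) ^ 2 ≤ (K : ℤ) ^ 2 := by
      apply sq_le_sq'  <;> omega
    have h2 : ((b : ℤ) - d) ^ 2 ≤ (K : ℤ) ^ 2 := by
      apply sq_le_sq'  <;> omega
    linarith

lemma norm_le_three_mul_gphi {p : GaussianInt} (hp : Irreducible p) (h : 2 < p.norm) :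
    2 ≤ gphi p ∧ p.norm ≤ 3 * gphi p := by
  have hex : ∃ K : ℕ, p.norm ≤ 2 * (K : ℤ) ^ 2 := by
    refine ⟨p.norm.natAbs, ?_⟩
    rw [abs_natCast_norm]
    nlinarith
  have hK := Nat.find_spec hex
  have hmin := @Nat.find_min _ _ hex
  generalize Nat.find hex = K at hK hmin
  obtain ⟨k, rfl⟩ : ∃ k, K = k + 2 := by
    refine ⟨K - 2, ?_⟩
    have : 2 ≤ K := by
      by_contra! hlt
      interval_cases K <;> norm_num at hK <;> omega
    omega
  have hlt := hmin (Nat.lt_succ_self (k + 1))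
  rw [not_le] at hlt
  have hc := sq_le_card_Bq hp.ne_zero hlt
  rw [← gphi_add_one_of_irreducible hp] at hc
  zify at hc ⊢
  push_cast at hc hK
  have hk : (4 : ℤ) ≤ ((k : ℤ) + 2) ^ 2 := by nlinarith [Int.natCast_nonneg k]
  rw [add_assoc (k : ℤ) 1 1, one_add_one_eq_two] at hc
  constructor <;> linarith

lemma isCanon_unique {z w : GaussianInt} (hz : IsCanon z) (hw : IsCanon w)
    (h : Associated z w) : z = w := by
  obtain ⟨u, rfl⟩ := h
  have hu : (u : GaussianInt).norm = 1 := by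
    rw [← abs_natCast_norm, Zsqrtd.norm_eq_one_iff.2 u.isUnit, Nat.cast_one]
  generalize (u : GaussianInt) = v at *
  obtain ⟨a, b⟩ := z
  obtain ⟨c, d⟩ := v
  rw [gaussian_norm_eq] at hu
  simp only [IsCanon, Zsqrtd.re_mul, Zsqrtd.im_mul] at hz hw hu
  have hc1 : c ≤ 1 := by nlinarith
  have hc2 : -1 ≤ c := by nlinarith
  have hd1 : d ≤ 1 := by nlinarith
  have hd2 : -1 ≤ d := by nlinarith
  obtain ⟨rfl, rfl⟩ : c = 1 ∧ d = 0 := by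
    interval_cases c <;> interval_cases d <;> simp_all <;> omega
  exact (mul_one _).symm

lemma exists_isCanon {z : GaussianInt} (hz : z ≠ 0) : ∃ w, IsCanon w ∧ Associated z w := by
  have hI : IsUnit (⟨0, 1⟩ : GaussianInt) := by
    rw [← Zsqrtd.norm_eq_one_iff]
    rfl
  obtain ⟨a, b⟩ := z
  have hz' : a ≠ 0 ∨ b ≠ 0 := by
    by_contra! h
    exact hz (by rw [h.1, h.2]; rfl)
  by_cases h1 : 0 < a ∧ 0 ≤ b
  · exact ⟨⟨a, b⟩, h1, Associated.refl _⟩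
  by_cases h2 : a ≤ 0 ∧ 0 < b
  · refine ⟨⟨b, -a⟩, ⟨h2.2, by simp [h2.1]⟩, Associated.symm ?_⟩
    convert associated_mul_unit_right (⟨b, -a⟩ : GaussianInt) _ hI using 1
    ext <;> simp
  by_cases h3 : a < 0 ∧ b ≤ 0
  · exact ⟨⟨-a, -b⟩, ⟨by simp [h3.1], by simp [h3.2]⟩,
      (Associated.refl (⟨a, b⟩ : GaussianInt)).neg_right⟩
  · refine ⟨⟨-b, a⟩, ⟨by simp; omega, by simp; omega⟩, ?_⟩
    convert associated_mul_unit_right (⟨a, b⟩ : GaussianInt) _ hI using 1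
    ext <;> simp

lemma dvd_star_of_norm_le_two {p x : GaussianInt} (hp : Irreducible p) (hc : IsCanon p)
    (hN : p.norm ≤ 2) (hx : 2 ∣ x.norm) : p ∣ star x := by
  have hu : p.norm ≠ 1 := fun h =>
    hp.not_isUnit (Zsqrtd.norm_eq_one_iff.1 (by rw [h]; rfl))
  obtain ⟨a, b⟩ := p
  obtain ⟨c, d⟩ := x
  rw [gaussian_norm_eq] at hu hN hx
  simp only [IsCanon] at hc hu hN hx
  have ha : a = 1 := by nlinarith
  have hb : b = 1 := by
    subst ha
    have : b ≤ 1 := by nlinarith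
    have : b ≠ 0 := by
      rintro rfl
      simp at hu
    omega
  subst ha hb
  have hpar : (c - d) % 2 = 0 := by
    rcases Int.emod_two_eq_zero_or_one c with hc | hc <;>
    rcases Int.emod_two_eq_zero_or_one d with hd | hd
    · omega
    · exfalso
      have h2 := Int.emod_eq_zero_of_dvd hx
      simp [Int.add_emod, pow_two, Int.mul_emod, hc, hd] at h2
    · exfalso
      have h2 := Int.emod_eq_zero_of_dvd hx
      simp [Int.add_emod, pow_two, Int.mul_emod, hc, hd] at h2
    · omega
  refine ⟨⟨(c - d) / 2, - ((c + d) / 2)⟩, ?_⟩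
  ext <;> simp <;> omega

lemma int_abs_le_sq (a : ℤ) : |a| ≤ a ^ 2 := by
  rw [← sq_abs]
  exact Int.le_self_sq _

lemma gphi_irreducible_bound {p : GaussianInt} (hp : Irreducible p) (hN : 2 < p.norm) :
    (1 + |(p.re : ℝ)|) * (1 + |(p.im : ℝ)|) ≤ 9 * gphi p := by
  have h := (norm_le_three_mul_gphi hp hN).2
  rw [gaussian_norm_eq] at h hN
  have h1 : |p.re| ≤ p.re ^ 2 := int_abs_le_sq _
  have h2 : |p.im| ≤ p.im ^ 2 := int_abs_le_sq _
  have h3 : 2 * (|p.re| * |p.im|) ≤ p.re ^ 2 + p.im ^ 2 := by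
    rw [← sq_abs p.re, ← sq_abs p.im, ← mul_assoc]
    exact two_mul_le_add_sq _ _
  have : (1 + |p.re|) * (1 + |p.im|) ≤ 9 * gphi p := by nlinarith
  exact_mod_cast this

/-- A summable majorant over all of `ℤ[i]` for the logarithms of the Euler factors. -/
def eulerMajorant (z : GaussianInt) : ℝ :=
  162 * (1 / (1 + |(z.re : ℝ)|) ^ 2 * (1 / (1 + |(z.im : ℝ)|) ^ 2))

lemma eulerMajorant_nonneg (z : GaussianInt) : 0 ≤ eulerMajorant z := by
  unfold eulerMajorant
  positivity

lemma summable_int_one_div_sq : Summable fun n : ℤ => 1 / (1 + |(n : ℝ)|) ^ 2 := by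
  have h : Summable fun n : ℕ => 1 / (1 + |((n : ℤ) : ℝ)|) ^ 2 := by
    have := (summable_nat_add_iff 1).2 (Real.summable_one_div_nat_pow.2 one_lt_two)
    refine this.congr fun n => ?_
    rw [Int.cast_natCast, Nat.abs_cast, Nat.cast_add, Nat.cast_one, add_comm]
  refine Summable.of_nat_of_neg h (h.congr fun n => ?_)
  rw [Int.cast_neg, abs_neg]

lemma summable_eulerMajorant : Summable eulerMajorant := by
  have h := (summable_int_one_div_sq.mul_of_nonneg summable_int_one_div_sq
    (fun n => by positivity) (fun n => by positivity)).mul_left 162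
  refine h.comp_injective (i := fun z : GaussianInt => (z.re, z.im)) fun z w hzw => ?_
  exact Zsqrtd.ext (congrArg Prod.fst hzw) (congrArg Prod.snd hzw)

/-- The summand of the singular series. -/
def singularTerm (x q : GaussianInt) : ℂ := gtau q x / (gphi q : ℂ) ^ 2

lemma singularTerm_mul {q₁ q₂ : GaussianInt} (h₁ : q₁ ≠ 0) (h₂ : q₂ ≠ 0) (h : IsCoprime q₁ q₂)
    (x : GaussianInt) :
    singularTerm x (q₁ * q₂) = singularTerm x q₁ * singularTerm x q₂ := by
  rw [singularTerm, gtau_mul h₁ h₂ h, gphi_mul h₁ h₂ h, mul_pow, mul_div_mul_comm]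
  rfl

lemma singularTerm_of_isUnit {u : GaussianInt} (hu : IsUnit u) (x : GaussianInt) :
    singularTerm x u = 1 := by
  simp [singularTerm, gtau_of_isUnit hu, gphi_of_isUnit hu]

lemma singularTerm_congr {q r : GaussianInt} (h : Associated q r) (hq : q ≠ 0)
    (x : GaussianInt) : singularTerm x r = singularTerm x q := by
  obtain ⟨u, rfl⟩ := h
  rw [singularTerm_mul hq u.ne_zero ⟨0, ↑u⁻¹, by simp⟩, singularTerm_of_isUnit u.isUnit, mul_one]

lemma singularTerm_prod (S : Finset GaussianInt) (h0 : ∀ p ∈ S, p ≠ 0)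
    (hS : (S : Set GaussianInt).Pairwise IsCoprime) (x : GaussianInt) :
    singularTerm x (∏ p ∈ S, p) = ∏ p ∈ S, singularTerm x p := by
  induction S using Finset.induction_on with
  | empty => simp [singularTerm_of_isUnit isUnit_one]
  | insert a S ha ih =>
    rw [Finset.prod_insert ha, Finset.prod_insert ha, singularTerm_mul, ih]
    · exact fun p hp => h0 p (Finset.mem_insert_of_mem hp)
    · exact hS.mono (by simp)
    · exact h0 a (Finset.mem_insert_self _ _)
    · exact Finset.prod_ne_zero_iff.2 fun p hp => h0 p (Finset.mem_insert_of_mem hp)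
    · refine IsCoprime.prod_right fun p hp => hS (by simp) (by simp [hp]) ?_
      rintro rfl
      exact ha hp

/-- Each Euler factor is real and bounded below by the exponential of the majorant. -/
lemma exists_euler_factor {p x : GaussianInt} (hp : Irreducible p) (hc : IsCanon p)
    (hx : 2 ∣ x.norm) :
    ∃ r : ℝ, 1 + singularTerm x p = r ∧ Real.exp (-eulerMajorant p) ≤ r := by
  by_cases hd : p ∣ star x
  · refine ⟨1 + gphi p / (gphi p : ℝ) ^ 2, ?_, ?_⟩
    · rw [singularTerm, gtau_of_dvd hp.ne_zero hd]
      push_cast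
      rfl
    · have h1 : Real.exp (-eulerMajorant p) ≤ 1 := by
        rw [Real.exp_le_one_iff, neg_nonpos]
        exact eulerMajorant_nonneg p
      have h2 : (0 : ℝ) ≤ gphi p / (gphi p : ℝ) ^ 2 := by positivity
      linarith
  · have hN : 2 < p.norm := by
      by_contra! h
      exact hd (dvd_star_of_norm_le_two hp hc h hx)
    refine ⟨1 - 1 / (gphi p : ℝ) ^ 2, ?_, ?_⟩
    · rw [singularTerm, gtau_irreducible_of_not_dvd hp hd]
      push_cast
      ring
    · have h2 : (2 : ℝ) ≤ gphi p := by exact_mod_cast (norm_le_three_mul_gphi hp hN).1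
      have hb := gphi_irreducible_bound hp hN
      set a : ℝ := 1 / (gphi p : ℝ) ^ 2 with ha
      have ha0 : 0 ≤ a := by positivity
      have ha1 : a ≤ 1 / 2 := by
        rw [ha]
        exact one_div_le_one_div_of_le (by norm_num) (by nlinarith)
      have hma : 2 * a ≤ eulerMajorant p := by
        have h3 : 0 < (1 + |(p.re : ℝ)|) * (1 + |(p.im : ℝ)|) := by positivity
        have h4 : ((1 + |(p.re : ℝ)|) * (1 + |(p.im : ℝ)|)) ^ 2 ≤ 81 * (gphi p : ℝ) ^ 2 := by
          calc _ ≤ (9 * (gphi p : ℝ)) ^ 2 := pow_le_pow_left₀ h3.le hb 2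
            _ = _ := by ring
        have h5 := one_div_le_one_div_of_le (by positivity) h4
        have h6 : 1 / (81 * (gphi p : ℝ) ^ 2) = a / 81 := by
          rw [ha]
          field_simp
        rw [h6] at h5
        have h7 : eulerMajorant p =
            162 * (1 / ((1 + |(p.re : ℝ)|) * (1 + |(p.im : ℝ)|)) ^ 2) := by
          rw [eulerMajorant, mul_pow, one_div_mul_one_div]
        rw [h7]
        linarith
      calc Real.exp (-eulerMajorant p) ≤ Real.exp (-(2 * a)) := by
            exact Real.exp_le_exp.2 (neg_le_neg hma)
        _ = (Real.exp (2 * a))⁻¹ := Real.exp_neg _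
        _ ≤ (2 * a + 1)⁻¹ := inv_anti₀ (by positivity) (Real.add_one_le_exp _)
        _ ≤ 1 - a := by
            rw [inv_le_iff_one_le_mul₀ (by positivity)]
            nlinarith

lemma norm_le_finite (Q : ℝ) : {z : GaussianInt | (z.norm : ℝ) ≤ Q}.Finite := by
  have hinj : Function.Injective fun z : GaussianInt => (z.re, z.im) := fun z w hzw =>
    Zsqrtd.ext (congrArg Prod.fst hzw) (congrArg Prod.snd hzw)
  refine Set.Finite.of_finite_image (Set.Finite.subset
    ((Set.finite_Icc (-⌊Q⌋) ⌊Q⌋).prod (Set.finite_Icc (-⌊Q⌋) ⌊Q⌋)) ?_) hinj.injOn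
  rintro _ ⟨z, hz, rfl⟩
  have h : z.norm ≤ ⌊Q⌋ := Int.le_floor.2 hz
  rw [gaussian_norm_eq] at h
  have h1 : |z.re| ≤ z.re ^ 2 := int_abs_le_sq _
  have h2 : |z.im| ≤ z.im ^ 2 := int_abs_le_sq _
  exact ⟨abs_le.1 (by nlinarith), abs_le.1 (by nlinarith)⟩

lemma canonPrimes_finite (Q : ℝ) :
    {p : GaussianInt | IsCanon p ∧ Irreducible p ∧ (p.norm : ℝ) ≤ Q}.Finite :=
  (norm_le_finite Q).subset fun _ h => h.2.2

/-- The canonical Gaussian primes of norm at most `Q`. -/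
def canonPrimes (Q : ℝ) : Finset GaussianInt := (canonPrimes_finite Q).toFinset

lemma mem_canonPrimes {Q : ℝ} {p : GaussianInt} :
    p ∈ canonPrimes Q ↔ IsCanon p ∧ Irreducible p ∧ (p.norm : ℝ) ≤ Q := by
  rw [canonPrimes, Set.Finite.mem_toFinset]
  rfl

lemma pairwise_isCoprime_canonPrimes {Q : ℝ} {S : Finset GaussianInt} (hS : S ⊆ canonPrimes Q) :
    (S : Set GaussianInt).Pairwise IsCoprime := by
  intro p hp r hr hne
  obtain ⟨hpc, hpi, -⟩ := mem_canonPrimes.1 (hS hp)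
  obtain ⟨hrc, hri, -⟩ := mem_canonPrimes.1 (hS hr)
  rw [hpi.coprime_iff_not_dvd]
  exact fun h => hne (isCanon_unique hpc hrc (hpi.associated_of_dvd hri h))

lemma dvd_prod_canonPrimes_iff {Q : ℝ} {S : Finset GaussianInt} (hS : S ⊆ canonPrimes Q)
    {p : GaussianInt} (hp : IsCanon p) (hpi : Irreducible p) : p ∣ ∏ r ∈ S, r ↔ p ∈ S := by
  refine ⟨fun h => ?_, fun h => Finset.dvd_prod_of_mem _ h⟩
  obtain ⟨r, hr, hpr⟩ := (hpi.prime.dvd_finsetProd_iff _).1 h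
  obtain ⟨hrc, hri, -⟩ := mem_canonPrimes.1 (hS hr)
  rwa [isCanon_unique hp hrc (hpi.associated_of_dvd hri hpr)]

lemma exists_canon_irreducible_dvd {q : GaussianInt} (hq : q ≠ 0) (hu : ¬ IsUnit q) :
    ∃ p, IsCanon p ∧ Irreducible p ∧ p ∣ q := by
  obtain ⟨r, hr, hrq⟩ := WfDvdMonoid.exists_irreducible_factor hu hq
  obtain ⟨p, hp, hpr⟩ := exists_isCanon hr.ne_zero
  exact ⟨p, hp, hpr.irreducible hr, hpr.symm.dvd.trans hrq⟩

lemma squarefree_prod_canonPrimes {Q : ℝ} {S : Finset GaussianInt} (hS : S ⊆ canonPrimes Q) :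
    Squarefree (∏ p ∈ S, p) :=
  Finset.squarefree_prod_of_pairwise_isCoprime
    (fun _ hp _ hr hne => (pairwise_isCoprime_canonPrimes hS hp hr hne).isRelPrime)
    fun _ hp => (mem_canonPrimes.1 (hS hp)).2.1.squarefree

lemma associated_prod_of_qSmooth {Q : ℝ} {q : GaussianInt} (hq : QSmooth Q q) :
    Associated (∏ p ∈ (canonPrimes Q).filter (· ∣ q), p) q := by
  set S := (canonPrimes Q).filter (· ∣ q) with hS
  obtain ⟨c, hc⟩ : ∏ p ∈ S, p ∣ q :=
    Finset.prod_dvd_of_coprime (pairwise_isCoprime_canonPrimes (Finset.filter_subset _ _))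
      fun p hp => (Finset.mem_filter.1 hp).2
  have hc0 : c ≠ 0 := by
    rintro rfl
    exact hq.1.ne_zero (by rw [hc, mul_zero])
  have hcu : IsUnit c := by
    by_contra hcu
    obtain ⟨p, hp, hpi, hpc⟩ := exists_canon_irreducible_dvd hc0 hcu
    have hpq : p ∣ q := hpc.trans ⟨_, by rw [hc, mul_comm]⟩
    have hpS : p ∈ S :=
      Finset.mem_filter.2 ⟨mem_canonPrimes.2 ⟨hp, hpi, hq.2 p hpi hpq⟩, hpq⟩
    refine hpi.not_isUnit (hq.1 p ?_)
    rw [hc]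
    exact mul_dvd_mul (Finset.dvd_prod_of_mem _ hpS) hpc
  rw [hc]
  exact associated_mul_unit_right _ _ hcu

lemma abs_gmu_of_squarefree {q : GaussianInt} (hq : Squarefree q) : |gmu q| = 1 := by
  rw [gmu, if_pos ⟨hq.ne_zero, hq⟩, abs_pow, abs_neg, abs_one, one_pow]

/-- The Euler product of the smooth singular series. -/
theorem singular_series_eq_prod (Q : ℝ) (x : GaussianInt) :
    (∑' q : {q : GaussianInt // IsCanon q ∧ QSmooth Q q},
        ((|gmu (q : GaussianInt)| : ℤ) : ℂ) * gtau (q : GaussianInt) x /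
          ((gphi (q : GaussianInt) : ℂ) ^ 2)) =
      ∏ p ∈ canonPrimes Q, (1 + singularTerm x p) := by
  have hex : ∀ S : (canonPrimes Q).powerset,
      ∃ q : {q : GaussianInt // IsCanon q ∧ QSmooth Q q}, Associated (∏ p ∈ S.1, p) q.1 := by
    rintro ⟨S, hS⟩
    rw [Finset.mem_powerset] at hS
    have hsq := squarefree_prod_canonPrimes hS
    obtain ⟨w, hw, hSw⟩ := exists_isCanon hsq.ne_zero
    refine ⟨⟨w, hw, hsq.squarefree_of_dvd hSw.symm.dvd, fun r hr hrw => ?_⟩, hSw⟩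
    obtain ⟨p, hp, hrp⟩ := (hr.prime.dvd_finsetProd_iff _).1 (hrw.trans hSw.symm.dvd)
    obtain ⟨-, hpi, hpQ⟩ := mem_canonPrimes.1 (hS hp)
    refine le_trans ?_ hpQ
    exact_mod_cast norm_le_of_dvd hpi.ne_zero hrp
  choose F hF using hex
  have hbij : Function.Bijective F := by
    constructor
    · rintro ⟨S, hS⟩ ⟨T, hT⟩ h
      have hST := (hF ⟨S, hS⟩).trans (h ▸ (hF ⟨T, hT⟩).symm)
      rw [Finset.mem_powerset] at hS hT
      refine Subtype.ext (Finset.ext fun p => ⟨fun hp => ?_, fun hp => ?_⟩)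
      · obtain ⟨hpc, hpi, -⟩ := mem_canonPrimes.1 (hS hp)
        exact (dvd_prod_canonPrimes_iff hT hpc hpi).1 ((Finset.dvd_prod_of_mem _ hp).trans hST.dvd)
      · obtain ⟨hpc, hpi, -⟩ := mem_canonPrimes.1 (hT hp)
        exact (dvd_prod_canonPrimes_iff hS hpc hpi).1
          ((Finset.dvd_prod_of_mem _ hp).trans hST.symm.dvd)
    · rintro ⟨q, hqc, hq⟩
      refine ⟨⟨(canonPrimes Q).filter (· ∣ q), Finset.mem_powerset.2 (Finset.filter_subset _ _)⟩,
        Subtype.ext ?_⟩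
      exact isCanon_unique (F _).2.1 hqc ((hF _).symm.trans (associated_prod_of_qSmooth hq))
  rw [← (Equiv.ofBijective F hbij).tsum_eq, Finset.prod_one_add, ← Finset.tsum_subtype]
  refine tsum_congr ?_
  rintro ⟨S, hS⟩
  have hsub := Finset.mem_powerset.1 hS
  rw [Equiv.ofBijective_apply, abs_gmu_of_squarefree (F ⟨S, hS⟩).2.2.1, Int.cast_one, one_mul,
    ← singularTerm_prod S (fun p hp => (mem_canonPrimes.1 (hsub hp)).2.1.ne_zero)
      (pairwise_isCoprime_canonPrimes hsub),
    ← singularTerm_congr (hF ⟨S, hS⟩) (squarefree_prod_canonPrimes hsub).ne_zero]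
  rfl

theorem singular_series_lower_bound :
    ∃ c : ℝ, 0 < c ∧ ∀ Q : ℝ, 2 ≤ Q → ∀ x : GaussianInt, 2 ∣ Zsqrtd.norm x →
      (∑' q : {q : GaussianInt // IsCanon q ∧ QSmooth Q q},
          ((|gmu (q : GaussianInt)| : ℤ) : ℂ) * gtau (q : GaussianInt) x /
            ((gphi (q : GaussianInt) : ℂ) ^ 2)).im = 0 ∧
      c ≤ (∑' q : {q : GaussianInt // IsCanon q ∧ QSmooth Q q},
          ((|gmu (q : GaussianInt)| : ℤ) : ℂ) * gtau (q : GaussianInt) x /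
            ((gphi (q : GaussianInt) : ℂ) ^ 2)).re := by
  refine ⟨Real.exp (-∑' z, eulerMajorant z), Real.exp_pos _, fun Q _ x hx => ?_⟩
  have hex : ∀ p ∈ canonPrimes Q, ∃ r : ℝ, 1 + singularTerm x p = r ∧
      Real.exp (-eulerMajorant p) ≤ r := fun p hp =>
    exists_euler_factor (mem_canonPrimes.1 hp).2.1 (mem_canonPrimes.1 hp).1 hx
  choose! r hr hle using hex
  rw [singular_series_eq_prod, Finset.prod_congr rfl hr, ← Complex.ofReal_prod]
  refine ⟨Complex.ofReal_im _, ?_⟩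
  rw [Complex.ofReal_re]
  calc Real.exp (-∑' z, eulerMajorant z)
      ≤ Real.exp (-∑ p ∈ canonPrimes Q, eulerMajorant p) :=
        Real.exp_le_exp.2 (neg_le_neg
          (summable_eulerMajorant.sum_le_tsum _ fun z _ => eulerMajorant_nonneg z))
    _ = ∏ p ∈ canonPrimes Q, Real.exp (-eulerMajorant p) := by
        rw [← Finset.sum_neg_distrib, Real.exp_sum]
    _ ≤ ∏ p ∈ canonPrimes Q, r p := Finset.prod_le_prod (fun _ _ => (Real.exp_pos _).le) hle

end
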